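/- There exists a constant C > 0, depending only on the integers k ≥ 1 and n > 2k, such that for all μ₁, μ₂ > 0 and all ξ₁, ξ₂ ∈ ℝⁿ one has ∫_{ℝⁿ} (U_{μ₁,ξ₁} U_{μ₂,ξ₂})^{2*_k/2} dx ≤ C · ε₁₂^{n/(n−2k)} · log(2 + ε₁₂^{−1}). -/

import Mathlib

open MeasureTheory Real

/-- The constant `𝔠_{n,k} := (∏_{j=-k}^{k-1} (n+2j))^{1/k}` (reindexed by `j ↦ j - k`). -/
noncomputable def cnk (n k : ℕ) : ℝ :=
  (∏ j ∈ Finset.range (2 * k), ((n : ℝ) + 2 * j - 2 * k)) ^ ((k : ℝ)⁻¹)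

/-- The standard bubble `U_{μ,ξ}(x) = μ^{(n-2k)/2} (μ² + 𝔠_{n,k}⁻¹ |x-ξ|²)^{(2k-n)/2}`. -/
noncomputable def stdBubble (n k : ℕ) (μ : ℝ) (ξ x : EuclideanSpace ℝ (Fin n)) : ℝ :=
  μ ^ (((n : ℝ) - 2 * k) / 2) *
    (μ ^ 2 + (cnk n k)⁻¹ * ‖x - ξ‖ ^ 2) ^ (((2 * k : ℝ) - n) / 2)

/-- The interaction quantity
`ε₁₂ = (μ₁/μ₂ + μ₂/μ₁ + 𝔠_{n,k}⁻¹ |ξ₁-ξ₂|²/(μ₁μ₂))^{(2k-n)/2}`. -/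
noncomputable def interact (n k : ℕ) (μ₁ μ₂ : ℝ)
    (ξ₁ ξ₂ : EuclideanSpace ℝ (Fin n)) : ℝ :=
  (μ₁ / μ₂ + μ₂ / μ₁ + (cnk n k)⁻¹ * ‖ξ₁ - ξ₂‖ ^ 2 / (μ₁ * μ₂)) ^ (((2 * k : ℝ) - n) / 2)

/-- The power of a product of two positive numbers whose sum is at least `S / 2`, bounded by
powers of `S` and of the individual factors. -/
lemma mul_rpow_neg_le {a b S h δ : ℝ} (ha : 0 < a) (hb : 0 < b) (hS : 0 < S)
    (hSab : S ≤ 2 * (a + b)) (hδ : 0 ≤ δ) (hδh : δ ≤ h) :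
    (a * b) ^ (-h) ≤ (S / 4) ^ (-(h - δ)) * (a ^ (-(h + δ)) + b ^ (-(h + δ))) := by
  wlog hab : a ≤ b generalizing a b
  · have := this hb ha (by linarith) (by linarith)
    rwa [mul_comm b a, add_comm (b ^ _)] at this
  have h1 : b ^ (-(h - δ)) ≤ (S / 4) ^ (-(h - δ)) :=
    rpow_le_rpow_of_nonpos (by positivity) (by linarith) (by linarith)
  have h2 : b ^ (-δ) ≤ a ^ (-δ) := rpow_le_rpow_of_nonpos ha hab (by linarith)
  calc (a * b) ^ (-h) = a ^ (-h) * (b ^ (-(h - δ)) * b ^ (-δ)) := by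
        rw [mul_rpow ha.le hb.le, ← rpow_add hb]; ring_nf
    _ ≤ a ^ (-h) * ((S / 4) ^ (-(h - δ)) * a ^ (-δ)) := by gcongr
    _ = (S / 4) ^ (-(h - δ)) * a ^ (-(h + δ)) := by
        rw [neg_add, rpow_add ha]; ring
    _ ≤ _ := by
        gcongr
        have := rpow_pos_of_pos hb (-(h + δ))
        linarith

lemma integral_Ioi_add_rpow {m s : ℝ} (hm : 0 < m) (hs : 0 < s) :
    ∫ r in Set.Ioi (0 : ℝ), (r + m) ^ (-(1 + s)) = m ^ (-s) / s := by
  have hd : ∀ r ∈ Set.Ici (0 : ℝ),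
      HasDerivAt (fun t : ℝ ↦ -((t + m) ^ (-s) / s)) ((r + m) ^ (-(1 + s))) r := by
    intro r hr
    have hr0 : r + m ≠ 0 := by have : 0 ≤ r := hr; positivity
    have h := ((((hasDerivAt_id r).add_const m).rpow_const (p := -s) (Or.inl hr0)).div_const s).neg
    refine h.congr_deriv ?_
    have : -s - 1 = -(1 + s) := by ring
    simp only [id, this]
    field_simp
  have ht : Filter.Tendsto (fun t : ℝ ↦ -((t + m) ^ (-s) / s)) Filter.atTop (nhds 0) := by
    have h := (((tendsto_rpow_neg_atTop hs).comp
      (Filter.tendsto_atTop_add_const_right _ m Filter.tendsto_id)).div_const s).neg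
    simpa using h
  rw [integral_Ioi_of_hasDerivAt_of_tendsto' hd
    (integrableOn_add_rpow_Ioi_of_lt (by linarith) (by linarith)) ht]
  simp

lemma integrable_add_norm_rpow {n : ℕ} {m s : ℝ} (hm : 0 < m) (hs : 0 < s)
    (ξ : EuclideanSpace ℝ (Fin n)) :
    Integrable (fun x : EuclideanSpace ℝ (Fin n) ↦ (‖x - ξ‖ + m) ^ (-(n + s))) := by
  have h0 : Integrable (fun x : EuclideanSpace ℝ (Fin n) ↦ (‖x‖ + m) ^ (-(n + s))) := by
    have h1 : Integrable (fun x : EuclideanSpace ℝ (Fin n) ↦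
        (min m 1) ^ (-(n + s)) * (1 + ‖x‖) ^ (-(n + s))) :=
      (integrable_one_add_norm (by simpa using hs)).const_mul _
    refine h1.mono' (Measurable.aestronglyMeasurable (by fun_prop)) (.of_forall fun x ↦ ?_)
    have hmin : 0 < min m 1 := by positivity
    rw [norm_of_nonneg (by positivity), ← mul_rpow hmin.le (by positivity)]
    refine rpow_le_rpow_of_nonpos (by positivity) ?_ (by have := n.cast_nonneg (α := ℝ); linarith)
    have h2 := min_le_left m 1
    have h3 := mul_le_mul_of_nonneg_right (min_le_right m 1) (norm_nonneg x)
    linarith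
  exact h0.comp_sub_right ξ

lemma integral_add_norm_rpow_le {n : ℕ} (hn : 0 < n) {m s : ℝ} (hm : 0 < m) (hs : 0 < s)
    (ξ : EuclideanSpace ℝ (Fin n)) :
    ∫ x : EuclideanSpace ℝ (Fin n), (‖x - ξ‖ + m) ^ (-(n + s)) ≤
      n * volume.real (Metric.ball (0 : EuclideanSpace ℝ (Fin n)) 1) * (m ^ (-s) / s) := by
  have : Nonempty (Fin n) := ⟨⟨0, hn⟩⟩
  rw [integral_sub_right_eq_self (fun x : EuclideanSpace ℝ (Fin n) ↦ (‖x‖ + m) ^ (-(n + s))) ξ,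
    integral_fun_norm_addHaar volume (fun r : ℝ ↦ (r + m) ^ (-(n + s))),
    finrank_euclideanSpace_fin, nsmul_eq_mul, smul_eq_mul, ← mul_assoc, ← integral_Ioi_add_rpow hm hs]
  refine mul_le_mul_of_nonneg_left ?_ (by positivity)
  have hint : IntegrableOn (fun r : ℝ ↦ (r + m) ^ (-(1 + s))) (Set.Ioi 0) :=
    integrableOn_add_rpow_Ioi_of_lt (by linarith) (by linarith)
  refine integral_mono_of_nonneg ?_ hint ?_
  · refine (ae_restrict_mem measurableSet_Ioi).mono fun r (hr : 0 < r) ↦ ?_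
    simp only [Pi.zero_apply, smul_eq_mul]
    positivity
  · refine (ae_restrict_mem measurableSet_Ioi).mono fun r (hr : 0 < r) ↦ ?_
    simp only [smul_eq_mul]
    calc r ^ (n - 1) * (r + m) ^ (-(n + s)) ≤ (r + m) ^ (n - 1) * (r + m) ^ (-(n + s)) := by
          gcongr; linarith
      _ = (r + m) ^ (-(1 + s)) := by
          rw [← rpow_natCast, ← rpow_add (by positivity), Nat.cast_sub hn]
          congr 1; push_cast; ring

/-- The square of `‖x - ξ‖ + m` is controlled by `m ^ 2 + c * ‖x - ξ‖ ^ 2`. -/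
lemma sq_add_mul_sq_rpow_neg_le {c m t h : ℝ} (hc : 0 < c) (hm : 0 < m) (ht : 0 ≤ t)
    (hh : 0 ≤ h) :
    (m ^ 2 + c * t ^ 2) ^ (-h) ≤ (min c 1 / 2) ^ (-h) * (t + m) ^ (-(2 * h)) := by
  have hmin : 0 < min c 1 := by positivity
  have h1 : (t + m) ^ (-(2 * h)) = ((t + m) ^ 2) ^ (-h) := by
    rw [← rpow_natCast, ← rpow_mul (by positivity)]; congr 1; push_cast; ring
  rw [h1, ← mul_rpow (by positivity) (by positivity)]
  refine rpow_le_rpow_of_nonpos (by positivity) ?_ (by linarith)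
  have h2 := mul_le_mul_of_nonneg_right (min_le_left c 1) (sq_nonneg t)
  have h3 := mul_le_mul_of_nonneg_right (min_le_right c 1) (sq_nonneg m)
  nlinarith [mul_nonneg hmin.le (sq_nonneg (t - m))]

lemma integral_mul_rpow_neg_le {n : ℕ} (hn : 0 < n) {c m₁ m₂ δ : ℝ} (hc : 0 < c) (hm₁ : 0 < m₁)
    (hm₂ : 0 < m₂) (hδ : 0 < δ) (hδn : δ ≤ 1 / 2) (ξ₁ ξ₂ : EuclideanSpace ℝ (Fin n)) :
    ∫ x : EuclideanSpace ℝ (Fin n),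
        ((m₁ ^ 2 + c * ‖x - ξ₁‖ ^ 2) * (m₂ ^ 2 + c * ‖x - ξ₂‖ ^ 2)) ^ (-((n : ℝ) / 2)) ≤
      ((m₁ ^ 2 + m₂ ^ 2 + c * ‖ξ₁ - ξ₂‖ ^ 2) / 4) ^ (-((n : ℝ) / 2 - δ)) *
        ((min c 1 / 2) ^ (-((n : ℝ) / 2 + δ)) *
          (n * volume.real (Metric.ball (0 : EuclideanSpace ℝ (Fin n)) 1) *
            ((m₁ ^ (-(2 * δ)) + m₂ ^ (-(2 * δ))) / (2 * δ)))) := by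
  have hn1 : (1 : ℝ) ≤ n := by exact_mod_cast hn
  have h2δ : 0 < 2 * δ := by linarith
  set S := m₁ ^ 2 + m₂ ^ 2 + c * ‖ξ₁ - ξ₂‖ ^ 2
  have hS : 0 < S := by positivity
  set K := (S / 4) ^ (-((n : ℝ) / 2 - δ))
  set D := (min c 1 / 2) ^ (-((n : ℝ) / 2 + δ))
  have hK : 0 < K := by positivity
  have hmin : 0 < min c 1 := by positivity
  have hD : 0 < D := by positivity
  have i₁ := integrable_add_norm_rpow hm₁ h2δ ξ₁
  have i₂ := integrable_add_norm_rpow hm₂ h2δ ξ₂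
  have hpt : ∀ x : EuclideanSpace ℝ (Fin n),
      ((m₁ ^ 2 + c * ‖x - ξ₁‖ ^ 2) * (m₂ ^ 2 + c * ‖x - ξ₂‖ ^ 2)) ^ (-((n : ℝ) / 2)) ≤
        K * (D * ((‖x - ξ₁‖ + m₁) ^ (-(n + 2 * δ)) + (‖x - ξ₂‖ + m₂) ^ (-(n + 2 * δ)))) := by
    intro x
    have htri : ‖ξ₁ - ξ₂‖ ≤ ‖x - ξ₁‖ + ‖x - ξ₂‖ := by
      rw [show ξ₁ - ξ₂ = (x - ξ₂) - (x - ξ₁) by abel, add_comm]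
      exact norm_sub_le _ _
    have hsq : ‖ξ₁ - ξ₂‖ ^ 2 ≤ 2 * (‖x - ξ₁‖ ^ 2 + ‖x - ξ₂‖ ^ 2) := by
      nlinarith [norm_nonneg (ξ₁ - ξ₂), sq_nonneg (‖x - ξ₁‖ - ‖x - ξ₂‖)]
    have hSle : S ≤ 2 * ((m₁ ^ 2 + c * ‖x - ξ₁‖ ^ 2) + (m₂ ^ 2 + c * ‖x - ξ₂‖ ^ 2)) := by
      have := mul_le_mul_of_nonneg_left hsq hc.le
      simp only [S]
      nlinarith [sq_nonneg m₁, sq_nonneg m₂]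
    refine (mul_rpow_neg_le (by positivity) (by positivity) hS hSle hδ.le (by linarith)).trans ?_
    have e : (n : ℝ) + 2 * δ = 2 * (n / 2 + δ) := by ring
    rw [e, mul_add D]
    gcongr
    · exact sq_add_mul_sq_rpow_neg_le hc hm₁ (norm_nonneg _) (by positivity)
    · exact sq_add_mul_sq_rpow_neg_le hc hm₂ (norm_nonneg _) (by positivity)
  refine (integral_mono_of_nonneg (.of_forall fun x ↦ by positivity)
    (((i₁.add i₂).const_mul D).const_mul K) (.of_forall hpt)).trans ?_
  rw [integral_const_mul, integral_const_mul, integral_add' i₁ i₂, add_div, mul_add (_ * _)]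
  gcongr
  · exact integral_add_norm_rpow_le hn hm₁ h2δ ξ₁
  · exact integral_add_norm_rpow_le hn hm₂ h2δ ξ₂

lemma cnk_pos {n k : ℕ} (hn : 2 * k < n) : 0 < cnk n k := by
  have : (2 * k : ℝ) < n := by exact_mod_cast hn
  refine rpow_pos_of_pos (Finset.prod_pos fun j _ ↦ ?_) _
  have := j.cast_nonneg (α := ℝ)
  linarith

lemma stdBubble_mul_rpow {n k : ℕ} (hn : 2 * k < n) {μ₁ μ₂ : ℝ} (h₁ : 0 < μ₁) (h₂ : 0 < μ₂)
    (ξ₁ ξ₂ x : EuclideanSpace ℝ (Fin n)) :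
    (stdBubble n k μ₁ ξ₁ x * stdBubble n k μ₂ ξ₂ x) ^ ((n : ℝ) / ((n : ℝ) - 2 * k)) =
      (μ₁ * μ₂) ^ ((n : ℝ) / 2) *
        ((μ₁ ^ 2 + (cnk n k)⁻¹ * ‖x - ξ₁‖ ^ 2) *
          (μ₂ ^ 2 + (cnk n k)⁻¹ * ‖x - ξ₂‖ ^ 2)) ^ (-((n : ℝ) / 2)) := by
  have hc := cnk_pos hn
  have hnk : (0 : ℝ) < n - 2 * k := by
    have : (2 * k : ℝ) < n := by exact_mod_cast hn
    linarith
  have e₁ : ((n : ℝ) - 2 * k) / 2 * (n / (n - 2 * k)) = n / 2 := by field_simp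
  have e₂ : ((2 * k : ℝ) - n) / 2 * (n / (n - 2 * k)) = -(n / 2) := by
    rw [← e₁]; ring
  unfold stdBubble
  rw [mul_mul_mul_comm, ← mul_rpow h₁.le h₂.le, ← mul_rpow (by positivity) (by positivity),
    mul_rpow (by positivity) (by positivity), ← rpow_mul (by positivity),
    ← rpow_mul (by positivity), e₁, e₂]

/-- A logarithmic choice of exponent absorbs any power of `A ≥ 1`. -/
lemma rpow_inv_log_le {A q : ℝ} (hA : 1 ≤ A) (hq : 1 / 2 ≤ q) :
    A ^ (log (2 + A ^ q))⁻¹ ≤ exp 2 := by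
  have hA0 : 0 < A := by linarith
  have hpos := rpow_pos_of_pos hA0 q
  have hL : 0 < log (2 + A ^ q) := log_pos (by linarith)
  have h1 : q * log A ≤ log (2 + A ^ q) := by
    rw [← log_rpow hA0]
    exact log_le_log hpos (by linarith)
  rw [rpow_def_of_pos hA0, exp_le_exp, ← div_eq_mul_inv, div_le_iff₀ hL]
  nlinarith [log_nonneg hA]

theorem stmt14 (k n : ℕ) (hk : 1 ≤ k) (hn : 2 * k < n) :
    ∃ C : ℝ, 0 < C ∧
      ∀ μ₁ μ₂ : ℝ, 0 < μ₁ → 0 < μ₂ → ∀ ξ₁ ξ₂ : EuclideanSpace ℝ (Fin n),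
        (∫ x : EuclideanSpace ℝ (Fin n),
            (stdBubble n k μ₁ ξ₁ x * stdBubble n k μ₂ ξ₂ x) ^
              ((n : ℝ) / ((n : ℝ) - 2 * k))) ≤
          C * interact n k μ₁ μ₂ ξ₁ ξ₂ ^ ((n : ℝ) / ((n : ℝ) - 2 * k)) *
            Real.log (2 + (interact n k μ₁ μ₂ ξ₁ ξ₂)⁻¹) := by
  have hc : 0 < (cnk n k)⁻¹ := inv_pos.2 (cnk_pos hn)
  have hn0 : 0 < n := by omega
  have hnk : (1 : ℝ) ≤ n - 2 * k := by
    have : ((2 * k + 1 : ℕ) : ℝ) ≤ n := by exact_mod_cast hn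
    push_cast at this
    linarith
  set c := (cnk n k)⁻¹ with hcdef
  have hmin : 0 < min c 1 := by positivity
  set B := (n : ℝ) * volume.real (Metric.ball (0 : EuclideanSpace ℝ (Fin n)) 1) with hB
  have hB0 : 0 < B := by
    have : 0 < volume.real (Metric.ball (0 : EuclideanSpace ℝ (Fin n)) 1) :=
      ENNReal.toReal_pos (Metric.measure_ball_pos _ _ one_pos).ne' measure_ball_lt_top.ne
    positivity
  refine ⟨4 ^ ((n : ℝ) / 2) * (min c 1 / 2) ^ (-((n : ℝ) / 2 + 1 / 2)) * B * (2 * exp 2),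
    by positivity, fun μ₁ μ₂ h₁ h₂ ξ₁ ξ₂ ↦ ?_⟩
  set A := μ₁ / μ₂ + μ₂ / μ₁ + c * ‖ξ₁ - ξ₂‖ ^ 2 / (μ₁ * μ₂) with hA
  have hA12 : μ₁ / μ₂ ≤ A := by
    have : 0 ≤ μ₂ / μ₁ + c * ‖ξ₁ - ξ₂‖ ^ 2 / (μ₁ * μ₂) := by positivity
    linarith
  have hA21 : μ₂ / μ₁ ≤ A := by
    have : 0 ≤ μ₁ / μ₂ + c * ‖ξ₁ - ξ₂‖ ^ 2 / (μ₁ * μ₂) := by positivity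
    linarith
  have hA1 : 1 ≤ A := by
    rcases le_total μ₁ μ₂ with h | h
    · exact ((one_le_div h₁).2 h).trans hA21
    · exact ((one_le_div h₂).2 h).trans hA12
  have hA0 : 0 < A := by linarith
  have hS : μ₁ ^ 2 + μ₂ ^ 2 + c * ‖ξ₁ - ξ₂‖ ^ 2 = A * (μ₁ * μ₂) := by
    rw [hA]; field_simp
  have hint : interact n k μ₁ μ₂ ξ₁ ξ₂ = A ^ (((2 * k : ℝ) - n) / 2) := rfl
  have hintp : interact n k μ₁ μ₂ ξ₁ ξ₂ ^ ((n : ℝ) / ((n : ℝ) - 2 * k)) =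
      A ^ (-((n : ℝ) / 2)) := by
    rw [hint, ← rpow_mul hA0.le]
    congr 1
    have : (n : ℝ) - 2 * k ≠ 0 := by linarith
    field_simp
    ring
  have hinv : (interact n k μ₁ μ₂ ξ₁ ξ₂)⁻¹ = A ^ (((n : ℝ) - 2 * k) / 2) := by
    rw [hint, ← rpow_neg hA0.le]; congr 1; ring
  rw [hintp, hinv]
  have hAL := rpow_inv_log_le hA1 (q := ((n : ℝ) - 2 * k) / 2) (by linarith)
  set L := log (2 + A ^ (((n : ℝ) - 2 * k) / 2)) with hL
  have hL1 : 1 ≤ L := by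
    rw [hL, le_log_iff_exp_le (by positivity)]
    have := one_le_rpow hA1 (z := ((n : ℝ) - 2 * k) / 2) (by linarith)
    linarith [exp_one_lt_three]
  obtain ⟨δ, hδ⟩ : ∃ δ, δ = L⁻¹ / 2 := ⟨_, rfl⟩
  have hδ0 : 0 < δ := by rw [hδ]; positivity
  have hδ1 : δ ≤ 1 / 2 := by
    have := inv_le_one_of_one_le₀ hL1
    linarith
  have h2δ : L⁻¹ = δ + δ := by linarith
  rw [h2δ, rpow_add hA0] at hAL
  have hLδ : ∀ t : ℝ, t / (2 * δ) = t * L := fun t ↦ by rw [two_mul, ← h2δ, div_inv_eq_mul]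
  simp_rw [stdBubble_mul_rpow hn h₁ h₂]
  rw [integral_const_mul]
  have key := integral_mul_rpow_neg_le hn0 hc h₁ h₂ hδ0 hδ1 ξ₁ ξ₂
  rw [hS, ← hB, hLδ] at key
  have hM : 0 < μ₁ * μ₂ := by positivity
  have hsum : (μ₁ * μ₂) ^ δ * (μ₁ ^ (-(2 * δ)) + μ₂ ^ (-(2 * δ))) ≤ 2 * A ^ δ := by
    have e : (μ₁ * μ₂) ^ δ * (μ₁ ^ (-(2 * δ)) + μ₂ ^ (-(2 * δ))) =
        (μ₂ / μ₁) ^ δ + (μ₁ / μ₂) ^ δ := by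
      rw [div_rpow h₂.le h₁.le, div_rpow h₁.le h₂.le, mul_rpow h₁.le h₂.le, two_mul,
        neg_add, rpow_add h₁, rpow_add h₂, rpow_neg h₁.le, rpow_neg h₂.le]
      field_simp
    rw [e, two_mul]
    gcongr
  have hsplit : (μ₁ * μ₂) ^ ((n : ℝ) / 2) * (A * (μ₁ * μ₂) / 4) ^ (-((n : ℝ) / 2 - δ)) =
      A ^ (-((n : ℝ) / 2)) * A ^ δ * (μ₁ * μ₂) ^ δ * 4 ^ ((n : ℝ) / 2 - δ) := by
    rw [div_rpow (by positivity) (by norm_num), mul_rpow hA0.le hM.le,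
      rpow_neg (by norm_num : (0 : ℝ) ≤ 4), div_inv_eq_mul,
      show -((n : ℝ) / 2 - δ) = -(n / 2) + δ by ring, rpow_add hA0, rpow_add hM, rpow_neg hM.le]
    field_simp
  have h4 : (4 : ℝ) ^ ((n : ℝ) / 2 - δ) ≤ 4 ^ ((n : ℝ) / 2) :=
    rpow_le_rpow_of_exponent_le (by norm_num) (by linarith)
  have hD : (min c 1 / 2) ^ (-((n : ℝ) / 2 + δ)) ≤ (min c 1 / 2) ^ (-((n : ℝ) / 2 + 1 / 2)) :=
    rpow_le_rpow_of_exponent_ge (by positivity) (by linarith [min_le_right c 1]) (by linarith)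
  have hexp : A ^ δ * ((μ₁ * μ₂) ^ δ * (μ₁ ^ (-(2 * δ)) + μ₂ ^ (-(2 * δ)))) ≤ 2 * exp 2 := by
    have := mul_le_mul_of_nonneg_left hsum (rpow_nonneg hA0.le δ)
    linarith
  calc _ ≤ _ := mul_le_mul_of_nonneg_left key (by positivity)
    _ = (A ^ (-((n : ℝ) / 2)) * A ^ δ * (μ₁ * μ₂) ^ δ * 4 ^ ((n : ℝ) / 2 - δ)) *
        ((min c 1 / 2) ^ (-((n : ℝ) / 2 + δ)) *
          (B * ((μ₁ ^ (-(2 * δ)) + μ₂ ^ (-(2 * δ))) * L))) := by rw [← hsplit]; ring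
    _ = 4 ^ ((n : ℝ) / 2 - δ) * (min c 1 / 2) ^ (-((n : ℝ) / 2 + δ)) * B *
        (A ^ δ * ((μ₁ * μ₂) ^ δ * (μ₁ ^ (-(2 * δ)) + μ₂ ^ (-(2 * δ))))) *
          A ^ (-((n : ℝ) / 2)) * L := by ring
    _ ≤ 4 ^ ((n : ℝ) / 2) * (min c 1 / 2) ^ (-((n : ℝ) / 2 + 1 / 2)) * B * (2 * exp 2) *
          A ^ (-((n : ℝ) / 2)) * L := by
        gcongr
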